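/- Let Q be a real r×m matrix, let 𝓘 be a finite nonempty family of r-element subsets I of {1,…,m} such that for each I ∈ 𝓘 the square submatrix Q_I of Q formed by the columns indexed by I is invertible, and let a ∈ ℝ^m. Then the vector Q·a belongs to the topological interior of the intersection over all I ∈ 𝓘 of the cones generated by the columns of Q_I if and only if, for every I ∈ 𝓘, every entry of the vector Q_I⁻¹·Q·a is strictly positive. -/

import Mathlib

/-- The cone generated by the columns of a real `r × m` matrix `A`: the set of all
nonnegative real linear combinations of the columns of `A`, i.e. all vectors `A·c`
with `c` a vector with nonnegative entries. -/
def colCone {r m : ℕ} (A : Matrix (Fin r) (Fin m) ℝ) : Set (Fin r → ℝ) :=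
  {x | ∃ c : Fin m → ℝ, (∀ i, 0 ≤ c i) ∧ x = A.mulVec c}

/-- The cone generated by the columns of an invertible matrix consists of the vectors whose
coordinates with respect to these columns are nonnegative. -/
theorem colCone_eq_preimage_of_isUnit {r : ℕ} {A : Matrix (Fin r) (Fin r) ℝ} (hA : IsUnit A) :
    colCone A = A⁻¹.mulVec ⁻¹' Set.univ.pi fun _ => Set.Ici 0 := by
  have hdet : IsUnit A.det := (Matrix.isUnit_iff_isUnit_det A).mp hA
  ext x
  simp only [colCone, Set.mem_ofPred_eq, Set.mem_preimage, Set.mem_univ_pi, Set.mem_Ici]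
  constructor
  · rintro ⟨c, hc, rfl⟩ i
    simpa [Matrix.mulVec_mulVec, Matrix.nonsing_inv_mul A hdet] using hc i
  · intro hx
    exact ⟨A⁻¹.mulVec x, hx, by simp [Matrix.mulVec_mulVec, Matrix.mul_nonsing_inv A hdet]⟩

/-- The map `x ↦ A⁻¹ x` attached to an invertible real matrix `A` is open. -/
theorem isOpenMap_inv_mulVec_of_isUnit {r : ℕ} {A : Matrix (Fin r) (Fin r) ℝ} (hA : IsUnit A) :
    IsOpenMap A⁻¹.mulVec := by
  have hdet : IsUnit A.det := (Matrix.isUnit_iff_isUnit_det A).mp hA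
  refine IsOpenMap.of_inverse (f' := A.mulVec) (by fun_prop) (fun x => ?_) fun x => ?_
  · simp [Matrix.mulVec_mulVec, Matrix.nonsing_inv_mul A hdet]
  · simp [Matrix.mulVec_mulVec, Matrix.mul_nonsing_inv A hdet]

/-- The interior of the cone generated by the columns of an invertible matrix consists of the
vectors whose coordinates with respect to these columns are positive. -/
theorem mem_interior_colCone_iff_of_isUnit {r : ℕ} {A : Matrix (Fin r) (Fin r) ℝ} (hA : IsUnit A)
    (x : Fin r → ℝ) : x ∈ interior (colCone A) ↔ ∀ i, 0 < A⁻¹.mulVec x i := by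
  rw [colCone_eq_preimage_of_isUnit hA,
    ← (isOpenMap_inv_mulVec_of_isUnit hA).preimage_interior_eq_interior_preimage (by fun_prop),
    interior_pi_set Set.finite_univ]
  simp

/-- Let `Q` be a real `r × m` matrix, let `𝓘` be a finite nonempty family of `r`-element
subsets `I` of `{1,…,m}` (encoded as embeddings `Fin r ↪ Fin m` selecting the columns)
such that for each `I ∈ 𝓘` the square submatrix `Q_I` of `Q` formed by the columns
indexed by `I` is invertible, and let `a ∈ ℝ^m`. Then the vector `Q·a` belongs to the
topological interior of the intersection over all `I ∈ 𝓘` of the cones generated by the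
columns of `Q_I` if and only if, for every `I ∈ 𝓘`, every entry of the vector
`Q_I⁻¹·Q·a` is strictly positive. -/
theorem mem_interior_iInter_colCone_iff_pos {r m : ℕ} (Q : Matrix (Fin r) (Fin m) ℝ)
    (𝓘 : Finset (Fin r ↪ Fin m)) (hne : 𝓘.Nonempty)
    (hinv : ∀ I ∈ 𝓘, IsUnit (Q.submatrix id ⇑I)) (a : Fin m → ℝ) :
    Q.mulVec a ∈ interior (⋂ I ∈ 𝓘, colCone (Q.submatrix id ⇑I)) ↔
      ∀ I ∈ 𝓘, ∀ i, 0 < (Q.submatrix id ⇑I)⁻¹.mulVec (Q.mulVec a) i := by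
  rw [Finset.interior_iInter]
  simp only [Set.mem_iInter]
  exact forall₂_congr fun I hI => mem_interior_colCone_iff_of_isUnit (hinv I hI) _
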